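/- arXiv:1110.1072 — 3 statements merged into one kernel-verified Lean document; each statement's English description precedes it below -/
import Mathlib

section
/- Let g be a finite-dimensional semisimple complex Lie algebra and let r ∈ g ⊗ g be such that: r satisfies the classical Yang–Baxter equation; the symmetric part s := r + swap(r) is g-invariant; and the linear map g* → g, f ↦ (f ⊗ id)(s), is bijective. Let δ(x) := x · r be the resulting factorizable Lie bialgebra structure and H_r := β(r). Then every biderivation D of (g, δ) is of the form D = ad_H for some H ∈ g with ⁅H, H_r⁆ = 0. In particular, any two biderivations of (g, δ) commute, i.e. the Lie algebra of biderivations is abelian. -/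
open TensorProduct

section PaperDefs

variable (K : Type*) [CommRing K] (L : Type*) [LieRing L] [LieAlgebra K L]

/-- The Lie bracket of `L`, as a bilinear map. -/
def bracketBilin : L →ₗ[K] L →ₗ[K] L :=
  LinearMap.mk₂ K (fun x y => ⁅x, y⁆) add_lie smul_lie lie_add lie_smul

/-- The linear map `β : L ⊗ L → L` induced by the Lie bracket, `β (a ⊗ b) = ⁅a, b⁆`. -/
noncomputable def bracketMap : L ⊗[K] L →ₗ[K] L :=
  TensorProduct.lift (bracketBilin K L)

/-- The cyclic permutation `σ : a ⊗ b ⊗ c ↦ c ⊗ a ⊗ b` on the triple tensor product. -/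
noncomputable def cyc : L ⊗[K] (L ⊗[K] L) ≃ₗ[K] L ⊗[K] (L ⊗[K] L) :=
  (TensorProduct.assoc K L L L).symm.trans (TensorProduct.comm K (L ⊗[K] L) L)

variable {K L}

/-- `δ` is a 1-cocycle with values in `L ⊗ L`, where `L ⊗ L` carries the module structure
`⁅x, a ⊗ b⁆ = ⁅x, a⁆ ⊗ b + a ⊗ ⁅x, b⁆`. -/
def IsCocycle (δ : L →ₗ[K] L ⊗[K] L) : Prop :=
  ∀ x y : L, δ ⁅x, y⁆ = ⁅x, δ y⁆ - ⁅y, δ x⁆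

/-- `δ : L → L ⊗ L` is antisymmetric: `swap ∘ δ = -δ`. -/
def IsAntisym (δ : L →ₗ[K] L ⊗[K] L) : Prop :=
  ∀ x : L, TensorProduct.comm K L L (δ x) = - δ x

/-- `δ` satisfies the co-Jacobi identity: `ξ + σ ξ + σ² ξ = 0` where
`ξ = (δ ⊗ id) (δ x)` and `σ` is the cyclic permutation. -/
noncomputable def CoJacobi (δ : L →ₗ[K] L ⊗[K] L) : Prop :=
  ∀ x : L,
    (TensorProduct.assoc K L L L) ((TensorProduct.map δ LinearMap.id) (δ x))
      + (cyc K L) ((TensorProduct.assoc K L L L) ((TensorProduct.map δ LinearMap.id) (δ x)))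
      + (cyc K L) ((cyc K L)
          ((TensorProduct.assoc K L L L) ((TensorProduct.map δ LinearMap.id) (δ x)))) = 0

/-- A Lie bialgebra structure on the Lie algebra `L` is an antisymmetric 1-cocycle
satisfying the co-Jacobi identity. -/
noncomputable def IsLieBialgebra (δ : L →ₗ[K] L ⊗[K] L) : Prop :=
  IsAntisym δ ∧ IsCocycle δ ∧ CoJacobi δ

/-- `D : L → L` is a derivation of the Lie bracket. -/
def IsDerivation (D : L →ₗ[K] L) : Prop :=
  ∀ x y : L, D ⁅x, y⁆ = ⁅D x, y⁆ + ⁅x, D y⁆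

/-- `D : L → L` is a coderivation of `δ`: `(D ⊗ id + id ⊗ D) ∘ δ = δ ∘ D`. -/
def IsCoderivation (δ : L →ₗ[K] L ⊗[K] L) (D : L →ₗ[K] L) : Prop :=
  ∀ x : L,
    (TensorProduct.map D (LinearMap.id : L →ₗ[K] L)
      + TensorProduct.map (LinearMap.id : L →ₗ[K] L) D) (δ x) = δ (D x)

/-- A biderivation of `(L, δ)` is a derivation of the bracket which is a coderivation of `δ`. -/
def IsBiderivation (δ : L →ₗ[K] L ⊗[K] L) (D : L →ₗ[K] L) : Prop :=
  IsDerivation D ∧ IsCoderivation δ D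

/-- The linear map `x ↦ ⁅x, r⁆ = x · r`, for a fixed `r ∈ L ⊗ L`. -/
noncomputable def adjMap (r : L ⊗[K] L) : L →ₗ[K] L ⊗[K] L where
  toFun x := ⁅x, r⁆
  map_add' x y := add_lie x y r
  map_smul' t x := smul_lie t x r

end PaperDefs

/-- The centralizer of an element `H`, as a Lie subalgebra. -/
def centralizerOf (K : Type*) [CommRing K] (L : Type*) [LieRing L] [LieAlgebra K L]
    (H : L) : LieSubalgebra K L where
  carrier := {x : L | ⁅x, H⁆ = 0}
  add_mem' := fun {a b} ha hb => by
    simp only [Set.mem_setOf_eq] at *; rw [add_lie, ha, hb, add_zero]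
  zero_mem' := zero_lie H
  smul_mem' := fun t a ha => by
    simp only [Set.mem_setOf_eq] at *; rw [smul_lie, ha, smul_zero]
  lie_mem' := fun {a b} ha hb => by
    simp only [Set.mem_setOf_eq] at *; rw [lie_lie, ha, hb]; simp

/-- `r ∈ L ⊗ L` satisfies the classical Yang-Baxter equation:
for some (equivalently, any) representation `r = Σᵢ aᵢ ⊗ bᵢ` one has
`[r¹², r¹³] + [r¹², r²³] + [r¹³, r²³] = 0` in `L ⊗ L ⊗ L`. -/
def SatisfiesCYBE {K : Type*} [CommRing K] {L : Type*} [LieRing L] [LieAlgebra K L]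
    (r : L ⊗[K] L) : Prop :=
  ∃ (n : ℕ) (a b : Fin n → L),
    r = ∑ i, a i ⊗ₜ[K] b i ∧
    ∑ i, ∑ j,
      ((⁅a i, a j⁆ ⊗ₜ[K] (b i ⊗ₜ[K] b j))
        + (a i ⊗ₜ[K] (⁅b i, a j⁆ ⊗ₜ[K] b j))
        + (a i ⊗ₜ[K] (a j ⊗ₜ[K] ⁅b i, b j⁆))) = (0 : L ⊗[K] (L ⊗[K] L))

/-- The symmetric part `r + r²¹` of `r`. -/
noncomputable def symPart {K : Type*} [CommRing K] {L : Type*} [LieRing L]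
    [LieAlgebra K L] (r : L ⊗[K] L) : L ⊗[K] L :=
  r + TensorProduct.comm K L L r

/-- `(g, r)` is factorizable: `r` satisfies CYBE, its symmetric part `s` is invariant and
the induced map `g* → g`, `f ↦ (f ⊗ id) s`, is bijective. -/
noncomputable def IsFactorizableRMatrix {K : Type*} [CommRing K] {L : Type*} [LieRing L]
    [LieAlgebra K L] (r : L ⊗[K] L) : Prop :=
  SatisfiesCYBE r ∧ (∀ x : L, ⁅x, symPart r⁆ = 0) ∧
    Function.Bijective (fun f : Module.Dual K L =>
      TensorProduct.lid K L
        ((TensorProduct.map f (LinearMap.id : L →ₗ[K] L)) (symPart r)))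


namespace LieAlgebra

section Radical

variable {K M : Type*} [Field K] [LieRing M] [LieAlgebra K M]

lemma map_derivedSeriesOfIdeal_le {N : Type*} [LieRing N] [LieAlgebra K N] (f : M →ₗ⁅K⁆ N)
    (I : LieIdeal K M) (J : LieIdeal K N) (h : I.map f ≤ J) (k : ℕ) :
    (derivedSeriesOfIdeal K M k I).map f ≤ derivedSeriesOfIdeal K N k J := by
  induction k with
  | zero => simpa using h
  | succ k ih =>
    rw [derivedSeriesOfIdeal_succ, derivedSeriesOfIdeal_succ]
    exact (LieIdeal.map_bracket_le f).trans (LieSubmodule.mono_lie ih ih)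

variable (K M) in
/-- The quotient map from a Lie algebra to its quotient by the radical. -/
def radicalQuotientHom : M →ₗ⁅K⁆ M ⧸ radical K M :=
  { (LieSubmodule.Quotient.mk' (radical K M) : M →ₗ[K] M ⧸ radical K M) with
    map_lie' := fun {x y} ↦ LieSubmodule.Quotient.mk_bracket (radical K M) x y }

variable [FiniteDimensional K M]

/-- The quotient of a Lie algebra by its radical has trivial radical. -/
lemma hasTrivialRadical_quotient_radical : HasTrivialRadical K (M ⧸ radical K M) := by
  refine hasTrivialRadical_of_no_solvable_ideals fun J hJ ↦ ?_
  let π := radicalQuotientHom K M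
  have hπ (x : M) : π x = 0 ↔ x ∈ radical K M := LieSubmodule.Quotient.mk_eq_zero _
  obtain ⟨k, hk⟩ := IsSolvable.solvable K J
  obtain ⟨l, hl⟩ := IsSolvable.solvable K (radical K M)
  rw [LieIdeal.derivedSeries_eq_bot_iff] at hk hl
  have hle : derivedSeriesOfIdeal K M k (J.comap π) ≤ radical K M := by
    intro x hx
    have := map_derivedSeriesOfIdeal_le π (J.comap π) J LieIdeal.map_comap_le k
      (LieIdeal.mem_map hx)
    rw [hk] at this
    exact (hπ x).1 (by simpa using this)
  have hsolv : IsSolvable (J.comap π) := by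
    refine IsSolvable.mk (R := K) (k := l + k) ((LieIdeal.derivedSeries_eq_bot_iff _ _).2 ?_)
    rw [derivedSeriesOfIdeal_add, eq_bot_iff, ← hl]
    exact derivedSeriesOfIdeal_mono hle l
  rw [LieIdeal.solvable_iff_le_radical] at hsolv
  rw [LieSubmodule.eq_bot_iff]
  intro y hy
  obtain ⟨x, rfl⟩ := LieSubmodule.Quotient.surjective_mk' (radical K M) y
  exact (hπ x).2 (hsolv (LieIdeal.mem_comap.2 hy))

/-- Ideals of a Lie algebra with non-degenerate Killing form are perfect. -/
lemma IsKilling.lie_ideal_self {S : Type*} [LieRing S] [LieAlgebra K S] [FiniteDimensional K S]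
    [IsKilling K S] (J : LieIdeal K S) : ⁅J, J⁆ = J := by
  have hle : ⁅J, J⁆ ≤ J := LieSubmodule.lie_le_left J J
  have hc := LieIdeal.isCompl_killingCompl (K := K) (L := S) ⁅J, J⁆
  have hab : IsLieAbelian (J ⊓ LieIdeal.killingCompl K S ⁅J, J⁆ : LieIdeal K S) := by
    rw [LieSubmodule.lie_abelian_iff_lie_self_eq_bot, eq_bot_iff, ← hc.inf_eq_bot]
    exact le_inf (LieSubmodule.mono_lie inf_le_left inf_le_left)
      ((LieSubmodule.lie_le_left _ _).trans inf_le_right)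
  have hbot := IsKilling.ideal_eq_bot_of_isLieAbelian (R := K) (J ⊓ LieIdeal.killingCompl K S ⁅J, J⁆)
  calc ⁅J, J⁆ = ⁅J, J⁆ ⊔ LieIdeal.killingCompl K S ⁅J, J⁆ ⊓ J := by rw [inf_comm, hbot, sup_bot_eq]
    _ = (⁅J, J⁆ ⊔ LieIdeal.killingCompl K S ⁅J, J⁆) ⊓ J := (sup_inf_assoc_of_le _ hle).symm
    _ = J := by rw [hc.sup_eq_top, top_inf_eq]

/-- Every element of an ideal `J` is a sum of an element of `⁅J, J⁆` and a radical element. -/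
lemma exists_mem_lie_add_mem_radical [CharZero K] (J : LieIdeal K M) {y : M} (hy : y ∈ J) :
    ∃ k ∈ ⁅J, J⁆, ∃ ρ ∈ radical K M, y = k + ρ := by
  have := hasTrivialRadical_quotient_radical (K := K) (M := M)
  let π := radicalQuotientHom K M
  have hπ (x : M) : π x = 0 ↔ x ∈ radical K M := LieSubmodule.Quotient.mk_eq_zero _
  have hsurj : Function.Surjective π := LieSubmodule.Quotient.surjective_mk' (radical K M)
  have hmem : π y ∈ LieIdeal.map π ⁅J, J⁆ := by
    rw [LieIdeal.map_bracket_eq π hsurj, IsKilling.lie_ideal_self]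
    exact LieIdeal.mem_map hy
  obtain ⟨k, hk⟩ := LieIdeal.mem_map_of_surjective hsurj hmem
  refine ⟨k, k.2, y - k, (hπ _).1 ?_, by simp⟩
  rw [map_sub, hk, sub_self]

end Radical

section Trace

open LieModule

variable {K M V : Type*} [Field K] [LieRing M] [LieAlgebra K M]
  [AddCommGroup V] [Module K V] [LieRingModule M V] [LieModule K M V]

/-- The trace form twisted by an endomorphism commuting with the action is invariant. -/
lemma trace_twisted_lie (φ : Module.End K V) (hφ : ∀ x : M, Commute φ (toEnd K M V x))
    (x y z : M) :
    LinearMap.trace K V (φ * toEnd K M V ⁅x, y⁆ * toEnd K M V z) =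
      LinearMap.trace K V (φ * toEnd K M V x * toEnd K M V ⁅y, z⁆) := by
  have h : LinearMap.trace K V (φ * (toEnd K M V y * toEnd K M V x) * toEnd K M V z) =
      LinearMap.trace K V (φ * toEnd K M V x * (toEnd K M V z * toEnd K M V y)) := by
    rw [← mul_assoc φ, (hφ y).eq, mul_assoc, mul_assoc, LinearMap.trace_mul_comm]
    simp only [mul_assoc]
  simp only [LieHom.map_lie, LieRing.of_associative_ring_bracket, mul_sub, sub_mul, map_sub, h]
  simp only [mul_assoc]

variable [CharZero K] [IsAlgClosed K] [FiniteDimensional K M] [FiniteDimensional K V]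

/-- A product of an operator commuting with the action, of an element, and of a bracket with
an element of the radical, is nilpotent. -/
lemma isNilpotent_mul_toEnd_lie_radical (φ : Module.End K V)
    (hφ : ∀ x : M, Commute φ (toEnd K M V x)) (a b : M) {ρ : M} (hρ : ρ ∈ radical K M) :
    IsNilpotent (φ * toEnd K M V a * toEnd K M V ⁅b, ρ⁆) := by
  have hφ' (x : M) (v : V) : φ ⁅x, v⁆ = ⁅x, φ v⁆ := LinearMap.congr_fun (hφ x).eq v
  set n := φ * toEnd K M V a * toEnd K M V ⁅b, ρ⁆ with hn
  have hnv (v : V) : n v = φ ⁅a, ⁅⁅b, ρ⁆, v⁆⁆ := rfl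
  suffices ∀ N : LieSubmodule K M V, (∀ v ∈ N, φ v ∈ N) → (∃ k, ∀ v ∈ N, (n ^ k) v = 0) →
      IsNilpotent n from this ⊥ (by simp) ⟨0, by simp⟩
  intro N
  induction N using WellFoundedGT.induction with
  | ind N ih =>
  rintro hN ⟨k, hk⟩
  by_cases htop : N = ⊤
  · exact ⟨k, LinearMap.ext fun v ↦ hk v (htop ▸ LieSubmodule.mem_top v)⟩
  have : Nontrivial (V ⧸ N) :=
    Submodule.Quotient.nontrivial_iff.2 (by simpa using htop)
  obtain ⟨χ, hχ⟩ := exists_nontrivial_weightSpace_of_isSolvable K (radical K M) (V ⧸ N)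
  let W : LieSubmodule K M (V ⧸ N) := weightSpaceOfIsLieTower K (V ⧸ N) χ
  have hW (v : V) : v ∈ W.comap (LieSubmodule.Quotient.mk' N) ↔
      ∀ σ : radical K M, ⁅(σ : M), v⁆ - χ σ • v ∈ N := by
    have : v ∈ W.comap (LieSubmodule.Quotient.mk' N) ↔
      ∀ σ : radical K M, ⁅σ, (LieSubmodule.Quotient.mk' N v)⁆ =
        χ σ • LieSubmodule.Quotient.mk' N v := mem_weightSpace _ _
    rw [this]
    refine forall_congr' fun σ ↦ ?_
    rw [← LieSubmodule.Quotient.mk_eq_zero, map_sub, map_smul, sub_eq_zero]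
    rfl
  obtain ⟨⟨w, hw⟩, hw0⟩ := exists_ne (0 : weightSpace (V ⧸ N) χ)
  obtain ⟨v₀, rfl⟩ := LieSubmodule.Quotient.surjective_mk' N w
  refine ih (W.comap (LieSubmodule.Quotient.mk' N)) (lt_of_le_of_ne ?_ ?_) ?_ ⟨k + 1, ?_⟩
  · exact fun v hv ↦ (hW v).2 fun σ ↦ sub_mem (N.lie_mem hv) (N.smul_mem _ hv)
  · intro h
    have : v₀ ∈ N := h ▸ hw
    exact hw0 (Subtype.ext ((LieSubmodule.Quotient.mk_eq_zero N).2 this))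
  · intro v hv
    rw [hW] at hv ⊢
    intro σ
    have := hN _ (hv σ)
    rwa [map_sub, map_smul, hφ'] at this
  · intro v hv
    rw [pow_succ, Module.End.mul_apply, hnv]
    refine hk _ (hN _ (N.lie_mem ?_))
    have h₁ := (hW _).1 hv ⟨ρ, hρ⟩
    have h₂ := (hW _).1 (LieSubmodule.lie_mem _ (x := b) hv) ⟨ρ, hρ⟩
    have h₃ := sub_mem (N.lie_mem (x := b) h₁) h₂
    rw [lie_sub, lie_smul, sub_sub_sub_cancel_right] at h₃
    rwa [lie_lie]

lemma trace_twisted_lie_radical (φ : Module.End K V)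
    (hφ : ∀ x : M, Commute φ (toEnd K M V x)) (a b : M) {ρ : M} (hρ : ρ ∈ radical K M) :
    LinearMap.trace K V (φ * toEnd K M V ⁅a, b⁆ * toEnd K M V ρ) = 0 := by
  rw [trace_twisted_lie φ hφ]
  exact (LinearMap.isNilpotent_trace_of_isNilpotent
    (isNilpotent_mul_toEnd_lie_radical φ hφ a b hρ)).eq_zero

/-- If a subalgebra `L` is isotropic for a twisted trace form, then `L` is orthogonal to the
derived algebra of its normalizer. -/
lemma trace_twisted_lie_normalizer (φ : Module.End K V)
    (hφ : ∀ x : M, Commute φ (toEnd K M V x)) (L : LieSubalgebra K M)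
    (hL : ∀ x ∈ L, ∀ y ∈ L, LinearMap.trace K V (φ * toEnd K M V x * toEnd K M V y) = 0)
    {a b y : M} (ha : a ∈ L.normalizer) (hb : b ∈ L.normalizer) (hy : y ∈ L) :
    LinearMap.trace K V (φ * toEnd K M V ⁅a, b⁆ * toEnd K M V y) = 0 := by
  let J : LieIdeal K L.normalizer :=
    { L.toSubmodule.comap L.normalizer.toSubmodule.subtype with
      lie_mem := fun {x m} hm ↦ L.ideal_in_normalizer x.2 hm }
  have hJ (x : L.normalizer) : x ∈ J ↔ (x : M) ∈ L := Iff.rfl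
  obtain ⟨k, hk, ρ, hρ, hkρ⟩ := exists_mem_lie_add_mem_radical J
    (y := ⟨y, L.le_normalizer hy⟩) hy
  have hφ' (x : L.normalizer) : Commute φ (toEnd K L.normalizer V x) := hφ x
  let c : L.normalizer := ⁅(⟨a, ha⟩ : L.normalizer), (⟨b, hb⟩ : L.normalizer)⁆
  change LinearMap.trace K V (φ * toEnd K L.normalizer V c *
    toEnd K L.normalizer V ⟨y, L.le_normalizer hy⟩) = 0
  rw [hkρ, map_add, mul_add, map_add, trace_twisted_lie_radical φ hφ' _ _ hρ, add_zero]
  clear hkρ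
  rw [← LieSubmodule.mem_toSubmodule, LieSubmodule.lieIdeal_oper_eq_linear_span'] at hk
  induction hk using Submodule.span_induction with
  | mem k hk =>
    obtain ⟨i, hi, j, hj, rfl⟩ := hk
    rw [← trace_twisted_lie φ hφ']
    exact hL _ (L.ideal_in_normalizer c.2 hi) _ hj
  | zero => simp
  | add u v _ _ hu hv => rw [map_add, mul_add, map_add, hu, hv, add_zero]
  | smul t u _ hu => rw [map_smul, mul_smul_comm, map_smul, hu, smul_zero]

end Trace

end LieAlgebra

section Contraction

variable {K g : Type*} [Field K] [LieRing g] [LieAlgebra K g]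

variable (K g) in
/-- Contraction of the first factor of a tensor with a linear form. -/
noncomputable def contractFst : g ⊗[K] g →ₗ[K] Module.Dual K g →ₗ[K] g :=
  dualTensorHom K (Module.Dual K g) g ∘ₗ TensorProduct.map (Module.Dual.eval K g) LinearMap.id

@[simp]
lemma contractFst_tmul (a b : g) (f : Module.Dual K g) :
    contractFst K g (a ⊗ₜ b) f = f a • b := by
  simp [contractFst]

lemma lid_map_id_eq_contractFst (u : g ⊗[K] g) (f : Module.Dual K g) :
    TensorProduct.lid K g (TensorProduct.map f LinearMap.id u) = contractFst K g u f := by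
  induction u with
  | zero => simp
  | tmul a b => simp
  | add u v hu hv => simp only [map_add, hu, hv, LinearMap.add_apply]

lemma apply_contractFst_comm (u : g ⊗[K] g) (f h : Module.Dual K g) :
    f (contractFst K g (TensorProduct.comm K g g u) h) = h (contractFst K g u f) := by
  induction u with
  | zero => simp
  | tmul a b => simp [mul_comm]
  | add u v hu hv => simp only [map_add, hu, hv, LinearMap.add_apply]

lemma contractFst_lie (x : g) (u : g ⊗[K] g) (f : Module.Dual K g) :
    contractFst K g ⁅x, u⁆ f =
      contractFst K g u (f ∘ₗ LieAlgebra.ad K g x) + ⁅x, contractFst K g u f⁆ := by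
  induction u with
  | zero => simp
  | tmul a b => simp [TensorProduct.LieModule.lie_tmul_right]
  | add u v hu hv =>
    simp only [lie_add, map_add, hu, hv, LinearMap.add_apply]
    abel

lemma comm_lie_tensor (x : g) (u : g ⊗[K] g) :
    TensorProduct.comm K g g ⁅x, u⁆ = ⁅x, TensorProduct.comm K g g u⁆ := by
  induction u with
  | zero => simp
  | tmul a b => simp [TensorProduct.LieModule.lie_tmul_right, add_comm]
  | add u v hu hv => simp only [lie_add, map_add, hu, hv]

lemma bracketMap_lie (x : g) (u : g ⊗[K] g) :
    bracketMap K g ⁅x, u⁆ = ⁅x, bracketMap K g u⁆ := by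
  induction u with
  | zero => simp
  | tmul a b =>
    simp [TensorProduct.LieModule.lie_tmul_right, bracketMap, bracketBilin, lie_lie]
  | add u v hu hv => simp only [lie_add, map_add, hu, hv]

lemma map_ad_add_map_ad (H : g) (u : g ⊗[K] g) :
    (TensorProduct.map (LieAlgebra.ad K g H : g →ₗ[K] g) (LinearMap.id : g →ₗ[K] g) +
      TensorProduct.map (LinearMap.id : g →ₗ[K] g) (LieAlgebra.ad K g H : g →ₗ[K] g)) u =
      ⁅H, u⁆ := by
  induction u with
  | zero => simp
  | tmul a b => simp [TensorProduct.LieModule.lie_tmul_right]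
  | add u v hu hv => simp only [lie_add, map_add, hu, hv]

/-- The Yang-Baxter equation contracted in its first two factors. -/
lemma SatisfiesCYBE.lie_contractFst {r : g ⊗[K] g} (hr : SatisfiesCYBE r)
    (f h : Module.Dual K g) :
    ⁅contractFst K g r f, contractFst K g r h⁆ =
      contractFst K g r (-(h ∘ₗ LieAlgebra.ad K g (contractFst K g r f)) -
        f ∘ₗ LieAlgebra.ad K g (contractFst K g (TensorProduct.comm K g g r) h)) := by
  obtain ⟨n, a, b, rfl, hab⟩ := hr
  have key := congrArg (TensorProduct.lid K g ∘ TensorProduct.map f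
    ((TensorProduct.lid K g).toLinearMap ∘ₗ TensorProduct.map h LinearMap.id)) hab
  simp only [Function.comp_apply, map_sum, map_add, TensorProduct.map_tmul, LinearMap.comp_apply,
    LinearEquiv.coe_coe, TensorProduct.lid_tmul, map_zero, LinearMap.id_apply,
    Finset.sum_add_distrib] at key
  simp only [map_sum, TensorProduct.comm_tmul, contractFst_tmul, LinearMap.sum_apply,
    LinearMap.sub_apply, LinearMap.neg_apply, LinearMap.comp_apply, LieAlgebra.ad_apply, sum_lie, lie_sum,
    smul_lie, lie_smul, map_smul, LinearMap.smul_apply, Finset.smul_sum, smul_eq_mul, sub_smul, neg_smul,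
    Finset.sum_smul, smul_smul, Finset.sum_sub_distrib, Finset.sum_neg_distrib] at key ⊢
  rw [Finset.sum_comm (f := fun i j ↦ (h (b j) * f ⁅a j, a i⁆) • b i),
    Finset.sum_comm (f := fun i j ↦ (f (a j) * h ⁅b j, a i⁆) • b i),
    Finset.sum_comm (f := fun i j ↦ (h (a i) * f (a j)) • ⁅b j, b i⁆), ← sub_eq_zero, ← key]
  simp only [mul_comm]
  abel

/-- The Yang-Baxter equation contracted in its last two factors. -/
lemma SatisfiesCYBE.lie_contractFst_comm {r : g ⊗[K] g} (hr : SatisfiesCYBE r)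
    (f h : Module.Dual K g) :
    ⁅contractFst K g (TensorProduct.comm K g g r) f,
      contractFst K g (TensorProduct.comm K g g r) h⁆ =
      -contractFst K g (TensorProduct.comm K g g r)
        (-(h ∘ₗ LieAlgebra.ad K g (contractFst K g r f)) -
          f ∘ₗ LieAlgebra.ad K g (contractFst K g (TensorProduct.comm K g g r) h)) := by
  obtain ⟨n, a, b, rfl, hab⟩ := hr
  have key := congrArg (TensorProduct.rid K g ∘ TensorProduct.map LinearMap.id
    ((TensorProduct.lid K K).toLinearMap ∘ₗ TensorProduct.map f h)) hab
  simp only [Function.comp_apply, map_sum, map_add, TensorProduct.map_tmul, LinearMap.comp_apply,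
    LinearEquiv.coe_coe, TensorProduct.lid_tmul, TensorProduct.rid_tmul, map_zero,
    LinearMap.id_apply, Finset.sum_add_distrib] at key
  simp only [map_sum, TensorProduct.comm_tmul, contractFst_tmul, LinearMap.sum_apply,
    LinearMap.sub_apply, LinearMap.neg_apply, LinearMap.comp_apply, LieAlgebra.ad_apply, sum_lie, lie_sum,
    smul_lie, lie_smul, map_smul, LinearMap.smul_apply, Finset.smul_sum, smul_eq_mul, sub_smul, neg_smul,
    Finset.sum_smul, smul_smul, Finset.sum_sub_distrib, Finset.sum_neg_distrib] at key ⊢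
  have h₁ (i j : Fin n) : (f (a j) * h ⁅b j, b i⁆) • a i = -((f (a j) * h ⁅b i, b j⁆) • a i) := by
    rw [← lie_skew, map_neg, mul_neg, neg_smul]
  have h₂ (i j : Fin n) : (h (b j) * f ⁅a j, b i⁆) • a i = -((f ⁅b i, a j⁆ * h (b j)) • a i) := by
    rw [← lie_skew, map_neg, mul_neg, neg_smul, mul_comm]
  rw [Finset.sum_congr rfl fun i _ ↦ Finset.sum_congr rfl fun j _ ↦ h₁ i j,
    Finset.sum_congr rfl fun i _ ↦ Finset.sum_congr rfl fun j _ ↦ h₂ i j,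
    Finset.sum_comm (f := fun i j ↦ (h (b i) * f (b j)) • ⁅a j, a i⁆), ← sub_eq_zero, ← key]
  simp only [mul_comm (h _) (f _), Finset.sum_neg_distrib]
  abel

/-- The image of `f ↦ (r₊ f, -r₋ f)` in `g × g`, for `r` a solution of the Yang-Baxter equation
with contractions `r₊` and `r₋`. -/
noncomputable def SatisfiesCYBE.lagrangian {r : g ⊗[K] g} (hr : SatisfiesCYBE r) :
    LieSubalgebra K (g × g) :=
  { LinearMap.range ((contractFst K g r).prod
      (-contractFst K g (TensorProduct.comm K g g r))) with
    lie_mem' := by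
      rintro _ _ ⟨f, rfl⟩ ⟨h, rfl⟩
      refine ⟨_, Prod.ext (hr.lie_contractFst f h).symm ?_⟩
      simpa using (hr.lie_contractFst_comm f h).symm }

lemma SatisfiesCYBE.mem_lagrangian {r : g ⊗[K] g} (hr : SatisfiesCYBE r) {x : g × g} :
    x ∈ hr.lagrangian ↔ ∃ f : Module.Dual K g,
      (contractFst K g r f, -contractFst K g (TensorProduct.comm K g g r) f) = x :=
  Iff.rfl

lemma apply_lie_of_equivariant {E : Module.Dual K g ≃ₗ[K] g}
    (hE : ∀ x f, E (f ∘ₗ LieAlgebra.ad K g x) = -⁅x, E f⁆) (x y z : g) :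
    E.symm ⁅x, y⁆ z = -E.symm y ⁅x, z⁆ := by
  have : E.symm ⁅x, y⁆ = -(E.symm y ∘ₗ LieAlgebra.ad K g x) := by
    rw [LinearEquiv.symm_apply_eq, map_neg, hE, neg_neg, LinearEquiv.apply_symm_apply]
  simp [this]

/-- All contractions of an invariant antisymmetric tensor vanish. -/
lemma contractFst_eq_zero_of_invariant [CharZero K] (E : Module.Dual K g ≃ₗ[K] g)
    (hE : ∀ x f, E (f ∘ₗ LieAlgebra.ad K g x) = -⁅x, E f⁆)
    (hsymm : ∀ f h : Module.Dual K g, f (E h) = h (E f))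
    (hcenter : ∀ z : g, (∀ x : g, ⁅x, z⁆ = 0) → z = 0) {u : g ⊗[K] g}
    (hu : ∀ x : g, ⁅x, u⁆ = 0) (hanti : TensorProduct.comm K g g u = -u) :
    contractFst K g u = 0 := by
  have hE' := apply_lie_of_equivariant hE
  have hsymm' (x y : g) : E.symm x y = E.symm y x := by
    simpa using hsymm (E.symm x) (E.symm y)
  let T : g →ₗ[K] g := contractFst K g u ∘ₗ E.symm.toLinearMap
  have hT (x y : g) : T ⁅x, y⁆ = ⁅x, T y⁆ := by
    have h := contractFst_lie x u (E.symm y)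
    have h' : E.symm ⁅x, y⁆ = -(E.symm y ∘ₗ LieAlgebra.ad K g x) := by
      ext z; simp [hE']
    rw [hu, map_zero, LinearMap.zero_apply] at h
    simp only [T, LinearMap.comp_apply, LinearEquiv.coe_coe, h', map_neg]
    exact (eq_neg_of_add_eq_zero_right h.symm).symm
  have hT' (x y : g) : ⁅x, T y⁆ = ⁅T x, y⁆ := by
    rw [← hT, ← lie_skew, map_neg, hT, lie_skew]
  have hskew (x y : g) : E.symm x (T y) = -E.symm (T x) y := by
    have h := apply_contractFst_comm u (E.symm x) (E.symm y)
    rw [hanti, map_neg, LinearMap.neg_apply, map_neg] at h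
    rw [hsymm' (T x)]
    exact neg_eq_iff_eq_neg.1 h
  have hz (x y z : g) : E.symm ⁅x, y⁆ (T z) = 0 := by
    have h : E.symm ⁅x, y⁆ (T z) = E.symm (T ⁅x, y⁆) z := by
      rw [hE', hT', ← hE', ← hT', hT]
    exact self_eq_neg.1 ((hskew _ _).trans (by rw [h]))
  ext1 f
  obtain ⟨z, rfl⟩ := E.symm.surjective f
  refine hcenter _ fun x ↦ (Module.forall_dual_apply_eq_zero_iff K _).1 fun f ↦ ?_
  obtain ⟨y, rfl⟩ := E.symm.surjective f
  exact neg_eq_zero.1 ((hE' x y (T z)).symm.trans (hz x y z))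

/-- An invariant form on a Lie algebra with non-degenerate Killing form is a trace form of the
adjoint representation twisted by an operator commuting with it. -/
lemma exists_commute_ad_trace_eq [FiniteDimensional K g] [LieAlgebra.IsKilling K g]
    (E : Module.Dual K g ≃ₗ[K] g)
    (hE : ∀ x f, E (f ∘ₗ LieAlgebra.ad K g x) = -⁅x, E f⁆) :
    ∃ T : Module.End K g, (∀ x, Commute T (LieAlgebra.ad K g x)) ∧
      ∀ x y, LinearMap.trace K g (T * LieAlgebra.ad K g x * LieAlgebra.ad K g y) =
        E.symm x y := by
  have hnd := LieAlgebra.IsKilling.killingForm_nondegenerate K g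
  let T : Module.End K g :=
    ((killingForm K g).toDual hnd).symm.toLinearMap ∘ₗ E.symm.toLinearMap
  have hκ (x y : g) : killingForm K g (T x) y = E.symm x y :=
    LinearMap.BilinForm.apply_toDual_symm_apply (hB := hnd) _ _
  have hT (x y : g) : T ⁅x, y⁆ = ⁅x, T y⁆ := by
    refine ((killingForm K g).toDual hnd).injective (LinearMap.ext fun z ↦ ?_)
    rw [LinearMap.BilinForm.toDual_def, LinearMap.BilinForm.toDual_def, hκ,
      apply_lie_of_equivariant hE, ← hκ, ← lie_skew x (T y), map_neg, LinearMap.neg_apply,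
      LieModule.traceForm_apply_lie_apply]
  refine ⟨T, fun x ↦ LinearMap.ext fun y ↦ hT x y, fun x y ↦ ?_⟩
  have hx : T * LieAlgebra.ad K g x = LieAlgebra.ad K g (T x) := by
    ext y
    change T ⁅x, y⁆ = ⁅T x, y⁆
    rw [← lie_skew, map_neg, hT, lie_skew]
  rw [hx, ← hκ, killingForm_apply_apply]
  rfl

end Contraction

section Factorizable

lemma eq_zero_of_forall_lie_eq_zero (K : Type*) {g : Type*} [Field K] [LieRing g] [LieAlgebra K g]
    [LieAlgebra.HasTrivialRadical K g] {z : g} (hz : ∀ x : g, ⁅x, z⁆ = 0) : z = 0 := by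
  have : z ∈ LieAlgebra.center K g := (LieModule.mem_maxTrivSubmodule K g g z).2 hz
  simpa using this

variable {K g : Type*} [Field K] [LieRing g] [LieAlgebra K g]

lemma contractFst_symPart (r : g ⊗[K] g) (f : Module.Dual K g) :
    contractFst K g (symPart r) f =
      contractFst K g r f + contractFst K g (TensorProduct.comm K g g r) f := by
  simp [symPart]

/-- The isomorphism from the dual given by the symmetric part of a factorizable tensor. -/
noncomputable def IsFactorizableRMatrix.equiv {r : g ⊗[K] g} (hr : IsFactorizableRMatrix r) :
    Module.Dual K g ≃ₗ[K] g :=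
  LinearEquiv.ofBijective (contractFst K g (symPart r)) <| by
    simpa only [lid_map_id_eq_contractFst] using hr.2.2

lemma IsFactorizableRMatrix.equiv_apply {r : g ⊗[K] g} (hr : IsFactorizableRMatrix r)
    (f : Module.Dual K g) : hr.equiv f = contractFst K g (symPart r) f := rfl

lemma IsFactorizableRMatrix.equiv_comp_ad {r : g ⊗[K] g} (hr : IsFactorizableRMatrix r)
    (x : g) (f : Module.Dual K g) :
    hr.equiv (f ∘ₗ LieAlgebra.ad K g x) = -⁅x, hr.equiv f⁆ := by
  have h := contractFst_lie x (symPart r) f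
  rw [hr.2.1, map_zero, LinearMap.zero_apply] at h
  exact eq_neg_of_add_eq_zero_left h.symm

lemma comm_comm_tensor (r : g ⊗[K] g) :
    TensorProduct.comm K g g (TensorProduct.comm K g g r) = r :=
  (TensorProduct.comm K g g).symm_apply_apply r

lemma IsFactorizableRMatrix.apply_equiv {r : g ⊗[K] g} (hr : IsFactorizableRMatrix r)
    (f h : Module.Dual K g) : f (hr.equiv h) = h (hr.equiv f) := by
  simp only [equiv_apply, contractFst_symPart, map_add, apply_contractFst_comm]
  rw [← apply_contractFst_comm r h f, add_comm]

lemma trace_prodMap_lie [FiniteDimensional K g] (T : Module.End K g) (x y : g × g) :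
    LinearMap.trace K (g × g) (T.prodMap (-T) * LieModule.toEnd K (g × g) (g × g) x *
      LieModule.toEnd K (g × g) (g × g) y) =
    LinearMap.trace K g (T * LieAlgebra.ad K g x.1 * LieAlgebra.ad K g y.1) -
      LinearMap.trace K g (T * LieAlgebra.ad K g x.2 * LieAlgebra.ad K g y.2) := by
  have : T.prodMap (-T) * LieModule.toEnd K (g × g) (g × g) x *
      LieModule.toEnd K (g × g) (g × g) y =
      (T * LieAlgebra.ad K g x.1 * LieAlgebra.ad K g y.1).prodMap
        (-(T * LieAlgebra.ad K g x.2 * LieAlgebra.ad K g y.2)) := rfl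
  rw [this, LinearMap.trace_prodMap', map_neg, sub_eq_add_neg]

variable [FiniteDimensional K g] [LieAlgebra.IsKilling K g] [CharZero K]

lemma IsFactorizableRMatrix.exists_eq_ad {r : g ⊗[K] g} (hr : IsFactorizableRMatrix r)
    {D : g →ₗ[K] g} (hD : IsBiderivation (adjMap r) D) :
    ∃ H : g, ⁅H, bracketMap K g r⁆ = 0 ∧ (H, H) ∈ hr.1.lagrangian.normalizer ∧
      (LieAlgebra.ad K g H : g →ₗ[K] g) = D := by
  let D' : LieDerivation K g g := ⟨D, fun x y ↦ by
    rw [hD.1, ← lie_skew y, sub_neg_eq_add, add_comm]⟩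
  obtain ⟨H, hH⟩ := LieDerivation.IsKilling.exists_eq_ad D'
  have hHD : (LieAlgebra.ad K g H : g →ₗ[K] g) = D := by
    rw [← LieDerivation.coe_ad_apply_eq_ad_apply, hH]
  have hinv (x : g) : ⁅x, ⁅H, r⁆⁆ = 0 := by
    have h := hD.2 x
    rw [← hHD, map_ad_add_map_ad] at h
    change ⁅H, ⁅x, r⁆⁆ = ⁅⁅H, x⁆, r⁆ at h
    rw [lie_lie, eq_sub_iff_add_eq] at h
    exact add_eq_left.1 h
  have hanti : TensorProduct.comm K g g ⁅H, r⁆ = -⁅H, r⁆ := by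
    have h := hr.2.1 H
    rw [symPart, lie_add] at h
    rw [comm_lie_tensor]
    exact eq_neg_of_add_eq_zero_right h
  have hzero := contractFst_eq_zero_of_invariant hr.equiv hr.equiv_comp_ad hr.apply_equiv
    (fun z hz ↦ eq_zero_of_forall_lie_eq_zero K hz) hinv hanti
  refine ⟨H, eq_zero_of_forall_lie_eq_zero K fun x ↦ ?_, ?_, hHD⟩
  · rw [← bracketMap_lie, ← bracketMap_lie, hinv, map_zero]
  · have h₁ (f : Module.Dual K g) : ⁅H, contractFst K g r f⁆ =
        contractFst K g r (-(f ∘ₗ LieAlgebra.ad K g H)) := by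
      have h := contractFst_lie H r f
      rw [hzero, LinearMap.zero_apply] at h
      rw [map_neg]
      exact eq_neg_of_add_eq_zero_right h.symm
    have h₂ (f : Module.Dual K g) : ⁅H, contractFst K g (TensorProduct.comm K g g r) f⁆ =
        contractFst K g (TensorProduct.comm K g g r) (-(f ∘ₗ LieAlgebra.ad K g H)) := by
      have h := contractFst_lie H (TensorProduct.comm K g g r) f
      rw [← comm_lie_tensor, hanti, map_neg, hzero, neg_zero, LinearMap.zero_apply] at h
      rw [map_neg]
      exact eq_neg_of_add_eq_zero_right h.symm
    rw [LieSubalgebra.mem_normalizer_iff]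
    rintro _ ⟨f, rfl⟩
    refine hr.1.mem_lagrangian.2 ⟨-(f ∘ₗ LieAlgebra.ad K g H), Prod.ext (h₁ f).symm ?_⟩
    change _ = ⁅H, -contractFst K g (TensorProduct.comm K g g r) f⁆
    rw [lie_neg, h₂]

variable [IsAlgClosed K]

/-- Elements of the diagonal of `g × g` normalizing the Lagrangian subalgebra commute. -/
lemma IsFactorizableRMatrix.lie_eq_zero_of_mem_normalizer {r : g ⊗[K] g}
    (hr : IsFactorizableRMatrix r) {H H' : g} (hH : (H, H) ∈ hr.1.lagrangian.normalizer)
    (hH' : (H', H') ∈ hr.1.lagrangian.normalizer) : ⁅H, H'⁆ = 0 := by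
  obtain ⟨T, hT, htr⟩ := exists_commute_ad_trace_eq hr.equiv hr.equiv_comp_ad
  have hB (x : g) (f : Module.Dual K g) : hr.equiv.symm x (hr.equiv f) = f x := by
    rw [hr.apply_equiv, LinearEquiv.apply_symm_apply]
  have hiso : ∀ x ∈ hr.1.lagrangian, ∀ y ∈ hr.1.lagrangian, LinearMap.trace K (g × g)
      (T.prodMap (-T) * LieModule.toEnd K (g × g) (g × g) x *
        LieModule.toEnd K (g × g) (g × g) y) = 0 := by
    rintro _ ⟨f, rfl⟩ _ ⟨h, rfl⟩
    rw [trace_prodMap_lie, htr, htr]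
    have hE (f) : hr.equiv f =
        contractFst K g r f + contractFst K g (TensorProduct.comm K g g r) f :=
      contractFst_symPart r f
    have hfh : hr.equiv.symm (contractFst K g r f) (hr.equiv h) =
        hr.equiv.symm (hr.equiv f) (contractFst K g (TensorProduct.comm K g g r) h) := by
      rw [hB, LinearEquiv.symm_apply_apply, apply_contractFst_comm]
    rw [hE, hE, map_add, map_add, LinearMap.add_apply, add_comm, add_left_cancel_iff] at hfh
    simp [hfh]
  have hφ (x : g × g) : Commute (T.prodMap (-T)) (LieModule.toEnd K (g × g) (g × g) x) := by
    refine LinearMap.ext fun y ↦ Prod.ext ?_ ?_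
    · exact LinearMap.congr_fun (hT x.1).eq y.1
    · exact (congrArg Neg.neg (LinearMap.congr_fun (hT x.2).eq y.2)).trans (lie_neg _ _).symm
  refine (Module.forall_dual_apply_eq_zero_iff K _).1 fun f ↦ ?_
  have h := LieAlgebra.trace_twisted_lie_normalizer _ hφ _ hiso hH hH'
    (hr.1.mem_lagrangian.2 ⟨f, rfl⟩)
  rw [trace_prodMap_lie, htr, htr] at h
  rw [← hB, hr.equiv_apply, contractFst_symPart]
  simpa using h

end Factorizable

/-- for a factorizable complex semisimple Lie bialgebra (g, δ) with
δ(x) = x · r, every biderivation is ad_H with ⁅H, H_r⁆ = 0; in particular the Lie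
algebra of biderivations is abelian. -/
theorem biderivations_of_factorizable_semisimple
    {g : Type*} [LieRing g] [LieAlgebra ℂ g] [FiniteDimensional ℂ g]
    [LieAlgebra.IsSemisimple ℂ g]
    (r : g ⊗[ℂ] g) (hfact : IsFactorizableRMatrix r) :
    (∀ D : g →ₗ[ℂ] g, IsBiderivation (adjMap r) D →
      ∃ H : g, ⁅H, bracketMap ℂ g r⁆ = 0 ∧ (LieAlgebra.ad ℂ g H : g →ₗ[ℂ] g) = D) ∧
    (∀ D E : g →ₗ[ℂ] g, IsBiderivation (adjMap r) D → IsBiderivation (adjMap r) E →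
      D ∘ₗ E = E ∘ₗ D) := by
  refine ⟨fun D hD ↦ ?_, fun D E hD hE ↦ ?_⟩
  · obtain ⟨H, hH, -, hHD⟩ := hfact.exists_eq_ad hD
    exact ⟨H, hH, hHD⟩
  · obtain ⟨H, -, hH, rfl⟩ := hfact.exists_eq_ad hD
    obtain ⟨H', -, hH', rfl⟩ := hfact.exists_eq_ad hE
    have h := hfact.lie_eq_zero_of_mem_normalizer hH hH'
    ext x
    change ⁅H, ⁅H', x⁆⁆ = ⁅H', ⁅H, x⁆⁆
    rw [leibniz_lie, h, zero_lie, zero_add]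
end

section
/- Let (g, δ) be a Lie bialgebra over K such that every derivation of g is inner, the center Z(g) = 0, and the only g-invariant element of g ⊗ g is 0. Then the map x ↦ ad_x is a linear bijection from ker δ = {x ∈ g : δ(x) = 0} onto the space of biderivations of (g, δ). -/
open TensorProduct

/-- The derivation of `L ⊗ L` induced by `ad x` is the module action of `x`. -/
theorem map_ad_add_map_ad_apply {K : Type*} [CommRing K] {L : Type*} [LieRing L] [LieAlgebra K L]
    (x : L) (u : L ⊗[K] L) :
    (TensorProduct.map (LieAlgebra.ad K L x : L →ₗ[K] L) (LinearMap.id : L →ₗ[K] L)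
      + TensorProduct.map (LinearMap.id : L →ₗ[K] L) (LieAlgebra.ad K L x)) u = ⁅x, u⁆ := by
  induction u with
  | zero => simp
  | add a b ha hb => rw [map_add, ha, hb, lie_add]
  | tmul a b => simp [TensorProduct.LieModule.lie_tmul_right]

/-- For a cocycle `δ`, `ad x` is a coderivation exactly when `δ x` is invariant. -/
theorem IsCocycle.isCoderivation_ad_iff {K : Type*} [CommRing K] {L : Type*} [LieRing L]
    [LieAlgebra K L] {δ : L →ₗ[K] L ⊗[K] L} (hδ : IsCocycle δ) (x : L) :
    IsCoderivation δ (LieAlgebra.ad K L x) ↔ ∀ y : L, ⁅y, δ x⁆ = 0 := by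
  refine forall_congr' fun y => ?_
  rw [map_ad_add_map_ad_apply, LieAlgebra.ad_apply, hδ x y, eq_comm, sub_eq_self]

/-- if every derivation of g is inner, Z(g) = 0 and the only invariant of
g ⊗ g is 0, then x ↦ ad_x is a bijection from ker δ onto the biderivations of (g, δ). -/
theorem ad_bijection_ker_onto_biderivations
    {K : Type*} [Field K] [CharZero K] {L : Type*} [LieRing L] [LieAlgebra K L]
    (δ : L →ₗ[K] L ⊗[K] L) (hδ : IsLieBialgebra δ)
    (hder : ∀ D : L →ₗ[K] L, IsDerivation D → ∃ x : L, D = LieAlgebra.ad K L x)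
    (hZ : LieAlgebra.center K L = ⊥)
    (hinv : ∀ u : L ⊗[K] L, (∀ x : L, ⁅x, u⁆ = 0) → u = 0) :
    (∀ x : L, δ x = 0 → IsBiderivation δ (LieAlgebra.ad K L x)) ∧
    (∀ D : L →ₗ[K] L, IsBiderivation δ D →
      ∃! x : L, δ x = 0 ∧ (LieAlgebra.ad K L x : L →ₗ[K] L) = D) := by
  constructor
  · intro x hx
    refine ⟨fun y z => ?_, (hδ.2.1.isCoderivation_ad_iff x).2 fun y => by rw [hx, lie_zero]⟩
    simp only [LieAlgebra.ad_apply]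
    exact leibniz_lie x y z
  · rintro D ⟨hD, hcoD⟩
    obtain ⟨x, rfl⟩ := hder D hD
    refine ⟨x, ⟨hinv _ ((hδ.2.1.isCoderivation_ad_iff x).1 hcoD), rfl⟩, ?_⟩
    rintro y ⟨-, hy⟩
    have hyx : y - x ∈ LieAlgebra.center K L :=
        (LieModule.mem_maxTrivSubmodule K L L (y - x)).2 fun z => by
          have h : ⁅y, z⁆ = ⁅x, z⁆ := LinearMap.congr_fun hy z
          rw [← lie_skew, sub_lie, h, sub_self, neg_zero]
    rw [hZ, LieSubmodule.mem_bot] at hyx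
    exact sub_eq_zero.1 hyx
end

section
/- Let g be a Lie algebra over K with center Z(g) = 0 and such that the only g-invariant element of g ⊗ g is 0, let V be a finite-dimensional vector space regarded as an abelian Lie algebra, and let l = g × V be the direct product Lie algebra. Then every Lie bialgebra structure δ on l satisfies δ(V) ⊆ V ⊗ V (where V ⊗ V is viewed inside l ⊗ l via the inclusion of V into l). -/
open TensorProduct

section ProdLie

variable (L M : Type*) [LieRing L] [LieRing M]

/-- The direct product of two Lie rings. -/
instance prodLieRing : LieRing (L × M) where
  bracket x y := (⁅x.1, y.1⁆, ⁅x.2, y.2⁆)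
  add_lie x y z := by ext <;> exact add_lie ..
  lie_add x y z := by ext <;> exact lie_add ..
  lie_self x := by ext <;> exact lie_self _
  leibniz_lie x y z := by ext <;> exact leibniz_lie ..

/-- The direct product of two Lie algebras. -/
instance prodLieAlgebra (K : Type*) [CommRing K] [LieAlgebra K L] [LieAlgebra K M] :
    LieAlgebra K (L × M) where
  lie_smul t x y := by ext <;> exact lie_smul ..

end ProdLie

/-- A central element acts trivially on the tensor square. -/
theorem lie_tensor_eq_zero_of_central {K L : Type*} [CommRing K] [LieRing L] [LieAlgebra K L]
    {z : L} (hz : ∀ y : L, ⁅z, y⁆ = 0) (w : L ⊗[K] L) : ⁅z, w⁆ = 0 := by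
  induction w with
  | zero => simp
  | add a b ha hb => rw [lie_add, ha, hb, add_zero]
  | tmul a b => simp [TensorProduct.LieModule.lie_tmul_right, hz]

section ProdTensor

variable {K g V : Type*} [LieRing g] [LieRing V]

/-- The bracket of the product with an abelian factor has trivial second component. -/
theorem prod_lie_eq_of_abelian [IsLieAbelian V] (a b : g × V) : ⁅a, b⁆ = (⁅a.1, b.1⁆, 0) :=
  Prod.ext rfl (trivial_lie_zero V V a.2 b.2)

/-- The value of a cocycle on an element of the abelian factor is invariant. -/
theorem lie_cocycle_inr_eq_zero [CommRing K] [LieAlgebra K g] [LieAlgebra K V] [IsLieAbelian V]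
    {δ : (g × V) →ₗ[K] (g × V) ⊗[K] (g × V)} (hδ : IsCocycle δ) (v : V) (y : g × V) :
    ⁅y, δ ((0 : g), v)⁆ = 0 := by
  have hcentral (z : g × V) : ⁅((0 : g), v), z⁆ = 0 := by
    rw [prod_lie_eq_of_abelian, zero_lie, Prod.mk_zero_zero]
  have h := hδ y ((0 : g), v)
  rwa [lie_tensor_eq_zero_of_central hcentral, sub_zero, ← lie_skew, hcentral, neg_zero, map_zero,
    eq_comm] at h

/-- The projection `l ⊗ l → g ⊗ g` is equivariant. -/
theorem map_fst_fst_lie [CommRing K] [LieAlgebra K g] [LieAlgebra K V] (y : g × V)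
    (u : (g × V) ⊗[K] (g × V)) :
    TensorProduct.map (LinearMap.fst K g V) (LinearMap.fst K g V) ⁅y, u⁆ =
      ⁅y.1, TensorProduct.map (LinearMap.fst K g V) (LinearMap.fst K g V) u⁆ := by
  induction u with
  | zero => simp
  | add a b ha hb => simp only [lie_add, map_add, ha, hb]
  | tmul a b =>
    simp only [TensorProduct.LieModule.lie_tmul_right, map_add, TensorProduct.map_tmul]
    rfl

/-- Contracting the second leg of `l ⊗ l` with a functional on `V` is equivariant. -/
theorem rid_map_fst_snd_lie [CommRing K] [LieAlgebra K g] [LieAlgebra K V] [IsLieAbelian V]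
    (f : V →ₗ[K] K) (y : g × V) (u : (g × V) ⊗[K] (g × V)) :
    TensorProduct.rid K g
        (TensorProduct.map (LinearMap.fst K g V) (f ∘ₗ LinearMap.snd K g V) ⁅y, u⁆) =
      ⁅y.1, TensorProduct.rid K g
        (TensorProduct.map (LinearMap.fst K g V) (f ∘ₗ LinearMap.snd K g V) u)⁆ := by
  induction u with
  | zero => simp
  | add a b ha hb => simp only [lie_add, map_add, ha, hb]
  | tmul a b =>
    simp [TensorProduct.LieModule.lie_tmul_right, trivial_lie_zero V V]

/-- Contracting the first leg of `l ⊗ l` with a functional on `V` is equivariant. -/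
theorem lid_map_snd_fst_lie [CommRing K] [LieAlgebra K g] [LieAlgebra K V] [IsLieAbelian V]
    (f : V →ₗ[K] K) (y : g × V) (u : (g × V) ⊗[K] (g × V)) :
    TensorProduct.lid K g
        (TensorProduct.map (f ∘ₗ LinearMap.snd K g V) (LinearMap.fst K g V) ⁅y, u⁆) =
      ⁅y.1, TensorProduct.lid K g
        (TensorProduct.map (f ∘ₗ LinearMap.snd K g V) (LinearMap.fst K g V) u)⁆ := by
  induction u with
  | zero => simp
  | add a b ha hb => simp only [lie_add, map_add, ha, hb]
  | tmul a b =>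
    simp [TensorProduct.LieModule.lie_tmul_right, trivial_lie_zero V V]

end ProdTensor

section VectorSpace

variable {K M V : Type*} [Field K] [AddCommGroup M] [Module K M] [AddCommGroup V] [Module K V]

/-- An element of `M ⊗ V` killed by all functionals on the second leg is zero. -/
theorem tensor_eq_zero_of_rid_lTensor (w : M ⊗[K] V)
    (h : ∀ f : V →ₗ[K] K, TensorProduct.rid K M (LinearMap.lTensor M f w) = 0) : w = 0 := by
  classical
  let b := Module.Basis.ofVectorSpace K V
  apply (TensorProduct.equivFinsuppOfBasisRight b).injective
  ext i
  simpa [TensorProduct.equivFinsuppOfBasisRight_apply] using h (b.coord i)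

/-- An element of `V ⊗ M` killed by all functionals on the first leg is zero. -/
theorem tensor_eq_zero_of_lid_rTensor (w : V ⊗[K] M)
    (h : ∀ f : V →ₗ[K] K, TensorProduct.lid K M (LinearMap.rTensor M f w) = 0) : w = 0 := by
  classical
  let b := Module.Basis.ofVectorSpace K V
  apply (TensorProduct.equivFinsuppOfBasisLeft b).injective
  ext i
  simpa [TensorProduct.equivFinsuppOfBasisLeft_apply] using h (b.coord i)

/-- The decomposition of the tensor square of a product into its four blocks. -/
theorem prod_tensor_decomposition (u : (M × V) ⊗[K] (M × V)) :
    u = TensorProduct.map (LinearMap.inl K M V) (LinearMap.inl K M V)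
          (TensorProduct.map (LinearMap.fst K M V) (LinearMap.fst K M V) u)
      + TensorProduct.map (LinearMap.inl K M V) (LinearMap.inr K M V)
          (TensorProduct.map (LinearMap.fst K M V) (LinearMap.snd K M V) u)
      + TensorProduct.map (LinearMap.inr K M V) (LinearMap.inl K M V)
          (TensorProduct.map (LinearMap.snd K M V) (LinearMap.fst K M V) u)
      + TensorProduct.map (LinearMap.inr K M V) (LinearMap.inr K M V)
          (TensorProduct.map (LinearMap.snd K M V) (LinearMap.snd K M V) u) := by
  induction u with
  | zero => simp
  | add a b ha hb =>
    simp only [map_add]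
    nth_rewrite 1 [ha, hb]
    abel
  | tmul a b =>
    have hsplit (c : M × V) : c = LinearMap.inl K M V c.1 + LinearMap.inr K M V c.2 := by simp
    nth_rewrite 1 [hsplit a, hsplit b]
    simp only [TensorProduct.map_tmul, TensorProduct.add_tmul, TensorProduct.tmul_add,
      LinearMap.fst_apply, LinearMap.snd_apply]
    abel

end VectorSpace

/-- if Z(g) = 0 and the only invariant of g ⊗ g is 0, then for any
finite-dimensional abelian V, every Lie bialgebra structure on l = g × V maps V
into V ⊗ V. -/
theorem delta_of_abelian_factor_lands_in_V_tensor_V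
    {K : Type*} [Field K] [CharZero K]
    {g : Type*} [LieRing g] [LieAlgebra K g]
    (hZ : LieAlgebra.center K g = ⊥)
    (hinv : ∀ u : g ⊗[K] g, (∀ x : g, ⁅x, u⁆ = 0) → u = 0)
    {V : Type*} [LieRing V] [LieAlgebra K V] [IsLieAbelian V] [FiniteDimensional K V]
    (δ : (g × V) →ₗ[K] (g × V) ⊗[K] (g × V)) (hδ : IsLieBialgebra δ) (v : V) :
    δ ((0 : g), v) ∈ LinearMap.range
      (TensorProduct.map
        ((LinearMap.inr K g V) : V →ₗ[K] g × V)
        ((LinearMap.inr K g V) : V →ₗ[K] g × V)) := by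
  have hu := lie_cocycle_inr_eq_zero hδ.2.1 v
  set u := δ ((0 : g), v)
  have hcenter (z : g) (hz : ∀ x : g, ⁅x, z⁆ = 0) : z = 0 := by
    have hmem : z ∈ LieAlgebra.center K g := (LieModule.mem_maxTrivSubmodule _ _ _ z).2 hz
    rwa [hZ, LieSubmodule.mem_bot] at hmem
  have hgg : TensorProduct.map (LinearMap.fst K g V) (LinearMap.fst K g V) u = 0 := by
    refine hinv _ fun x => ?_
    simpa [hu] using (map_fst_fst_lie (x, (0 : V)) u).symm
  have hgV : TensorProduct.map (LinearMap.fst K g V) (LinearMap.snd K g V) u = 0 := by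
    refine tensor_eq_zero_of_rid_lTensor _ fun f => ?_
    rw [← LinearMap.comp_apply, LinearMap.lTensor_comp_map]
    refine hcenter _ fun x => ?_
    rw [← rid_map_fst_snd_lie f (x, (0 : V)) u, hu, map_zero, map_zero]
  have hVg : TensorProduct.map (LinearMap.snd K g V) (LinearMap.fst K g V) u = 0 := by
    refine tensor_eq_zero_of_lid_rTensor _ fun f => ?_
    rw [← LinearMap.comp_apply, LinearMap.rTensor_comp_map]
    refine hcenter _ fun x => ?_
    rw [← lid_map_snd_fst_lie f (x, (0 : V)) u, hu, map_zero, map_zero]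
  refine ⟨TensorProduct.map (LinearMap.snd K g V) (LinearMap.snd K g V) u, ?_⟩
  have hdec := prod_tensor_decomposition u
  rw [hgg, hgV, hVg] at hdec
  simpa using hdec.symm
end
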